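/- arXiv:2602.08330 — 2 statements merged into one kernel-verified Lean document; each statement's English description precedes it below -/
import Mathlib

section
/- Let $M^n$, $n \geq 3$, be an $n$-dimensional submanifold of an $m$-dimensional, $m \geq 4$, Riemannian manifold of quasi-constant curvature $(\widetilde{M}^m, \widetilde{g})$ with associated functions $p, q$ and distinguished unit vector field $V$. If $V$ is everywhere tangent to $M^n$, then $\rho + \rho_N \leq \Vert H \Vert^2 + p + \frac{2q}{n}$, and if $V$ is everywhere normal to $M^n$, then $\rho + \rho_N \leq \Vert H \Vert^2 + p$. -/
open Finset Matrix

/-- Kronecker delta (the components of the metric in an orthonormal frame). -/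
noncomputable def kdelta {k : ℕ} (a b : Fin k) : ℝ := if a = b then 1 else 0

/-- The scalar curvature `tau = sum_{i<j} R(e_i, e_j, e_j, e_i)` computed from the
components of the curvature tensor in an orthonormal frame. -/
noncomputable def scalarCurv {n : ℕ} (R : Fin n → Fin n → Fin n → Fin n → ℝ) : ℝ :=
  ∑ i : Fin n, ∑ j : Fin n, if i < j then R i j j i else 0

/-- The normalized scalar curvature `rho = 2 tau / (n (n - 1))`. -/
noncomputable def normScalarCurv {n : ℕ} (R : Fin n → Fin n → Fin n → Fin n → ℝ) : ℝ :=
  2 * scalarCurv R / ((n : ℝ) * ((n : ℝ) - 1))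

/-- The normal scalar curvature `K_N = -(1/4) sum_{r,s} trace ([A_r, A_s]^2)` computed from
the shape operators (given as symmetric matrices in an orthonormal tangent frame). -/
noncomputable def KN {n p : ℕ} (A : Fin p → Matrix (Fin n) (Fin n) ℝ) : ℝ :=
  -(1 / 4) * ∑ r : Fin p, ∑ s : Fin p,
    Matrix.trace ((A r * A s - A s * A r) * (A r * A s - A s * A r))

/-- The normalized normal scalar curvature `rho_N = (2/(n(n-1))) sqrt(K_N)`. -/
noncomputable def rhoN {n p : ℕ} (A : Fin p → Matrix (Fin n) (Fin n) ℝ) : ℝ :=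
  2 / ((n : ℝ) * ((n : ℝ) - 1)) * Real.sqrt (KN A)

/-- The squared mean curvature `|H|^2 = sum_r ((1/n) trace A_r)^2` computed from the
components of the second fundamental form in adapted orthonormal frames. -/
noncomputable def meanCurvSq {n p : ℕ} (A : Fin p → Matrix (Fin n) (Fin n) ℝ) : ℝ :=
  ∑ r : Fin p, ((1 / (n : ℝ)) * ∑ i : Fin n, A r i i) ^ 2

/-- The normalized normal scalar curvature
`rho^perp = (2/(n(n-1))) sqrt( sum_{i<j} sum_{r<s} (Rperp(e_i,e_j,v_r,v_s))^2 )`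
computed from the components of the normal curvature tensor. -/
noncomputable def rhoPerp {n p : ℕ} (Rp : Fin n → Fin n → Fin p → Fin p → ℝ) : ℝ :=
  2 / ((n : ℝ) * ((n : ℝ) - 1)) *
    Real.sqrt (∑ i : Fin n, ∑ j : Fin n, ∑ r : Fin p, ∑ s : Fin p,
      if i < j ∧ r < s then Rp i j r s ^ 2 else 0)

/-- The Ricci curvature `Ric(e_b, e_c) = sum_a R(e_a, e_b, e_c, e_a)` computed from the
components of the curvature tensor in an orthonormal frame. -/
noncomputable def ambRicci {m : ℕ} (Rt : Fin m → Fin m → Fin m → Fin m → ℝ)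
    (b c : Fin m) : ℝ :=
  ∑ a : Fin m, Rt a b c a

/-- The (ambient) scalar curvature `tau = sum_{a<b} sigma(e_a, e_b) = (1/2) sum_a Ric(e_a,e_a)`. -/
noncomputable def ambScalar {m : ℕ} (Rt : Fin m → Fin m → Fin m → Fin m → ℝ) : ℝ :=
  (1 / 2) * ∑ a : Fin m, ambRicci Rt a a

section DDVV
variable {ι κ : Type*} [Fintype ι] [Fintype κ]

theorem Matrix.IsSymm.trace_mul_self {A : Matrix ι ι ℝ} (hA : A.IsSymm) :
    trace (A * A) = ∑ i, ∑ j, A i j ^ 2 := by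
  simp only [trace, diag_apply, mul_apply]
  exact sum_congr rfl fun i _ => sum_congr rfl fun j _ => by rw [hA.apply i j, sq]

theorem trace_sum_smul_mul_self {Q : κ → Matrix ι ι ℝ}
    (horth : ∀ a b, a ≠ b → trace (Q a * Q b) = 0) (c : κ → ℝ) :
    trace ((∑ a, c a • Q a) * ∑ a, c a • Q a) = ∑ a, c a ^ 2 * trace (Q a * Q a) := by
  rw [sum_mul, trace_sum]
  refine sum_congr rfl fun a _ => ?_
  rw [mul_sum, trace_sum, sum_eq_single a (fun b _ hb => by simp [horth a b hb.symm]) (by simp)]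
  simp
  ring

variable [DecidableEq ι]

theorem Matrix.IsSymm.exists_orthogonal_diagonal {A : Matrix ι ι ℝ} (hA : A.IsSymm) :
    ∃ (U : Matrix ι ι ℝ) (d : ι → ℝ), Uᵀ * U = 1 ∧ U * Uᵀ = 1 ∧ A = U * diagonal d * Uᵀ := by
  have hH : A.IsHermitian := by
    rw [Matrix.IsHermitian, conjTranspose_eq_transpose_of_trivial]; exact hA
  refine ⟨hH.eigenvectorUnitary, hH.eigenvalues, ?_, ?_, ?_⟩
  · simpa [star_eq_conjTranspose, conjTranspose_eq_transpose_of_trivial] using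
      (Unitary.coe_star_mul_self hH.eigenvectorUnitary)
  · simpa [star_eq_conjTranspose, conjTranspose_eq_transpose_of_trivial] using
      (Unitary.coe_mul_star_self hH.eigenvectorUnitary)
  · simpa [Unitary.conjStarAlgAut_apply, star_eq_conjTranspose,
      conjTranspose_eq_transpose_of_trivial, Function.comp_def] using hH.spectral_theorem

theorem excess_star_le {l : ι → ℝ} (hl : ∑ i, l i ^ 2 ≤ 1) (c : ι) {J : Finset ι} (hc : c ∉ J) :
    ∑ j ∈ J, ((l c - l j) ^ 2 - 1) ≤ 1 := by
  have h1 : l c ^ 2 + ∑ j ∈ J, l j ^ 2 ≤ 1 := by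
    rw [← sum_insert (f := fun j => l j ^ 2) hc]
    exact (sum_le_sum_of_subset_of_nonneg (subset_univ _) fun _ _ _ => sq_nonneg _).trans hl
  have h2 := sq_sum_le_card_mul_sum_sq (s := J) (f := l)
  have h3 : ∑ j ∈ J, ((l c - l j) ^ 2 - 1) =
      #J * l c ^ 2 - 2 * l c * ∑ j ∈ J, l j + ∑ j ∈ J, l j ^ 2 - #J := by
    rw [mul_sum, ← nsmul_eq_mul, ← sum_const, ← sum_sub_distrib, ← sum_add_distrib,
      ← mul_one (#J : ℝ), ← nsmul_eq_mul, ← sum_const, ← sum_sub_distrib]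
    exact sum_congr rfl fun _ _ => by ring
  rw [h3]
  have hk : (0 : ℝ) ≤ #J := by positivity
  nlinarith [sq_nonneg (l c + ∑ j ∈ J, l j), mul_le_mul_of_nonneg_left h1 hk]

theorem exists_center_of_sum_sq_le_one [Nonempty ι] {l : ι → ℝ} (hl : ∑ i, l i ^ 2 ≤ 1) :
    ∃ c, ∀ i j, 1 < (l i - l j) ^ 2 → i = c ∨ j = c := by
  have hsum : ∀ J : Finset ι, ∑ j ∈ J, l j ^ 2 ≤ 1 := fun J =>
    (sum_le_sum_of_subset_of_nonneg (subset_univ _) fun _ _ _ => sq_nonneg _).trans hl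
  have hne : ∀ i j, 1 < (l i - l j) ^ 2 → i ≠ j := by
    rintro i j h rfl
    norm_num at h
  have hmeet : ∀ a b i j, 1 < (l a - l b) ^ 2 → 1 < (l i - l j) ^ 2 →
      i = a ∨ i = b ∨ j = a ∨ j = b := by
    intro a b i j hab hij
    by_contra! hcon
    obtain ⟨h1, h2, h3, h4⟩ := hcon
    have := hsum {a, b, i, j}
    rw [sum_insert (by simp [hne _ _ hab, h1.symm, h3.symm]),
      sum_insert (by simp [h2.symm, h4.symm]), sum_pair (hne _ _ hij)] at this
    nlinarith [sq_nonneg (l a + l b), sq_nonneg (l i + l j)]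
  have htri : ∀ a b k, 1 < (l a - l b) ^ 2 → 1 < (l b - l k) ^ 2 → ¬ 1 < (l a - l k) ^ 2 := by
    intro a b k hab hbk hak
    have := hsum {a, b, k}
    rw [sum_insert (by simp [hne _ _ hab, hne _ _ hak]), sum_pair (hne _ _ hbk)] at this
    nlinarith [sq_nonneg (l a + l b + l k)]
  have hsymm : ∀ i j, 1 < (l i - l j) ^ 2 → 1 < (l j - l i) ^ 2 := fun i j h => by
    rwa [sub_sq_comm]
  by_contra! hcon
  obtain ⟨a, b, hab, -, -⟩ := hcon (Classical.arbitrary ι)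
  obtain ⟨i, j, hij, hia, hja⟩ := hcon a
  obtain ⟨k, hbk, hka⟩ : ∃ k, 1 < (l b - l k) ^ 2 ∧ k ≠ a := by
    rcases hmeet a b i j hab hij with h | h | h | h
    · exact absurd h hia
    · exact ⟨j, h ▸ hij, hja⟩
    · exact absurd h hja
    · exact ⟨i, h ▸ hsymm _ _ hij, hia⟩
  obtain ⟨i, j, hij, hib, hjb⟩ := hcon b
  have h1 := hmeet a b i j hab hij
  have h2 := hmeet b k i j hbk hij
  have h3 := htri a b k hab hbk
  have h4 := hsymm i j hij
  grind

theorem sum_excess_le {l : ι → ℝ} (hl : ∑ i, l i ^ 2 ≤ 1) :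
    ∑ i, ∑ j, max ((l i - l j) ^ 2 - 1) 0 ≤ 2 := by
  rcases isEmpty_or_nonempty ι with _ | _
  · simp
  obtain ⟨c, hc⟩ := exists_center_of_sum_sq_le_one hl
  have hz : ∀ i j, i ≠ c → j ≠ c → max ((l i - l j) ^ 2 - 1) 0 = 0 := by
    intro i j hi hj
    have := mt (hc i j) (by tauto)
    exact max_eq_right (by linarith)
  have hcc : max ((l c - l c) ^ 2 - 1) 0 = 0 := by norm_num
  have hrow : ∑ j, max ((l c - l j) ^ 2 - 1) 0 ≤ 1 := by
    have hstar := excess_star_le hl c (J := univ.filter fun j => 1 < (l c - l j) ^ 2) (by simp)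
    rw [sum_filter] at hstar
    refine le_of_eq_of_le (sum_congr rfl fun j _ => ?_) hstar
    split_ifs with h
    · exact max_eq_left (by linarith)
    · exact max_eq_right (by linarith)
  have hother : ∑ i ∈ univ.erase c, ∑ j, max ((l i - l j) ^ 2 - 1) 0 =
      ∑ j, max ((l c - l j) ^ 2 - 1) 0 := by
    rw [← add_sum_erase univ (fun j => max ((l c - l j) ^ 2 - 1) 0) (mem_univ c), hcc, zero_add]
    refine sum_congr rfl fun i hi => ?_
    rw [sum_eq_single c (fun j _ hj => hz i j (ne_of_mem_erase hi) hj) (by simp), sub_sq_comm]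
  rw [← add_sum_erase univ _ (mem_univ c), hother]
  linarith

theorem trace_commutator_diagonal_sq (d : ι → ℝ) {Q : Matrix ι ι ℝ} (hQ : Q.IsSymm) :
    -trace ((diagonal d * Q - Q * diagonal d) * (diagonal d * Q - Q * diagonal d)) =
      ∑ i, ∑ j, (d i - d j) ^ 2 * Q i j ^ 2 := by
  simp only [trace, diag_apply, mul_apply (M := _ - _), Matrix.sub_apply, diagonal_mul, mul_diagonal,
    ← sum_neg_distrib]
  exact sum_congr rfl fun i _ => sum_congr rfl fun j _ => by rw [hQ.apply i j]; ring

theorem sum_sq_entry_le_half {Q : κ → Matrix ι ι ℝ} (hsymm : ∀ a, (Q a).IsSymm)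
    (horth : ∀ a b, a ≠ b → trace (Q a * Q b) = 0) (hnorm : ∀ a, trace (Q a * Q a) ≤ 1)
    {i j : ι} (hij : i ≠ j) : ∑ a, Q a i j ^ 2 ≤ 1 / 2 := by
  set S := ∑ a, Q a i j ^ 2 with hS
  set V := ∑ a, Q a i j • Q a with hV
  have hVs : V.IsSymm := by
    rw [Matrix.IsSymm, hV, transpose_sum]
    exact sum_congr rfl fun a _ => by rw [transpose_smul, hsymm a]
  have hVij : V i j = S := by
    simp [hV, hS, Matrix.sum_apply, sq]
  have hup : trace (V * V) ≤ S := by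
    rw [hV, trace_sum_smul_mul_self horth]
    exact sum_le_sum fun a _ => mul_le_of_le_one_right (sq_nonneg _) (hnorm a)
  have hlow : V i j ^ 2 + V j i ^ 2 ≤ trace (V * V) := by
    rw [hVs.trace_mul_self]
    calc V i j ^ 2 + V j i ^ 2 ≤ (∑ b, V i b ^ 2) + ∑ b, V j b ^ 2 := by
          gcongr
          · exact single_le_sum (f := fun b => V i b ^ 2) (fun _ _ => sq_nonneg _) (mem_univ j)
          · exact single_le_sum (f := fun b => V j b ^ 2) (fun _ _ => sq_nonneg _) (mem_univ i)
      _ = ∑ a ∈ {i, j}, ∑ b, V a b ^ 2 := by rw [sum_pair hij]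
      _ ≤ _ := sum_le_sum_of_subset_of_nonneg (subset_univ _)
          fun _ _ _ => sum_nonneg fun _ _ => sq_nonneg _
  rw [hVs.apply i j, hVij] at hlow
  by_contra! hcon
  nlinarith

theorem sum_excess_commutator_diagonal_le {d : ι → ℝ} (hd : ∑ i, d i ^ 2 ≤ 1)
    {Q : κ → Matrix ι ι ℝ} (hsymm : ∀ a, (Q a).IsSymm)
    (horth : ∀ a b, a ≠ b → trace (Q a * Q b) = 0) (hnorm : ∀ a, trace (Q a * Q a) ≤ 1) :
    ∑ a, max (-trace ((diagonal d * Q a - Q a * diagonal d) *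
      (diagonal d * Q a - Q a * diagonal d)) - 1) 0 ≤ 1 := by
  have hterm : ∀ a, max (-trace ((diagonal d * Q a - Q a * diagonal d) *
      (diagonal d * Q a - Q a * diagonal d)) - 1) 0 ≤
      ∑ i, ∑ j, max ((d i - d j) ^ 2 - 1) 0 * Q a i j ^ 2 := by
    intro a
    refine max_le ?_ (by positivity)
    have h1 := hnorm a
    rw [(hsymm a).trace_mul_self] at h1
    calc _ ≤ ∑ i, ∑ j, (d i - d j) ^ 2 * Q a i j ^ 2 - ∑ i, ∑ j, Q a i j ^ 2 := by
          rw [trace_commutator_diagonal_sq d (hsymm a)]; linarith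
      _ = ∑ i, ∑ j, ((d i - d j) ^ 2 - 1) * Q a i j ^ 2 := by
          simp only [← sum_sub_distrib, sub_mul, one_mul]
      _ ≤ _ := by gcongr; exact le_max_left _ _
  calc _ ≤ ∑ a, ∑ i, ∑ j, max ((d i - d j) ^ 2 - 1) 0 * Q a i j ^ 2 :=
        sum_le_sum fun a _ => hterm a
    _ = ∑ i, ∑ j, max ((d i - d j) ^ 2 - 1) 0 * ∑ a, Q a i j ^ 2 := by
        rw [sum_comm]
        refine sum_congr rfl fun i _ => ?_
        rw [sum_comm]
        simp only [mul_sum]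
    _ ≤ ∑ i, ∑ j, max ((d i - d j) ^ 2 - 1) 0 * (1 / 2) := by
        refine sum_le_sum fun i _ => sum_le_sum fun j _ => ?_
        rcases eq_or_ne i j with rfl | hij
        · norm_num
        · exact mul_le_mul_of_nonneg_left (sum_sq_entry_le_half hsymm horth hnorm hij)
            (le_max_right _ _)
    _ ≤ 1 := by
        simp only [← sum_mul]
        linarith [sum_excess_le hd]

theorem sum_excess_commutator_le {X : Matrix ι ι ℝ} (hX : X.IsSymm) (hX1 : trace (X * X) ≤ 1)
    {Q : κ → Matrix ι ι ℝ} (hsymm : ∀ a, (Q a).IsSymm)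
    (horth : ∀ a b, a ≠ b → trace (Q a * Q b) = 0) (hnorm : ∀ a, trace (Q a * Q a) ≤ 1) :
    ∑ a, max (-trace ((X * Q a - Q a * X) * (X * Q a - Q a * X)) - 1) 0 ≤ 1 := by
  obtain ⟨U, d, hU, hU', rfl⟩ := hX.exists_orthogonal_diagonal
  have hconj : ∀ Y Z : Matrix ι ι ℝ, Uᵀ * Y * U * (Uᵀ * Z * U) = Uᵀ * (Y * Z) * U := by
    intro Y Z
    calc _ = Uᵀ * Y * (U * Uᵀ) * Z * U := by simp only [mul_assoc]
      _ = _ := by rw [hU']; simp only [mul_assoc, one_mul]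
  have htr : ∀ Y : Matrix ι ι ℝ, trace (Uᵀ * Y * U) = trace Y := by
    intro Y
    rw [trace_mul_comm, ← mul_assoc, hU', one_mul]
  have hD : diagonal d = Uᵀ * (U * diagonal d * Uᵀ) * U := by
    calc _ = (Uᵀ * U) * diagonal d * (Uᵀ * U) := by rw [hU, one_mul, mul_one]
      _ = _ := by simp only [mul_assoc]
  have hd : ∑ i, d i ^ 2 ≤ 1 := by
    rw [← htr, ← hconj, ← hD, diagonal_mul_diagonal, trace_diagonal] at hX1
    simpa only [sq] using hX1
  have key := sum_excess_commutator_diagonal_le hd (Q := fun a => Uᵀ * Q a * U)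
    (fun a => by
      rw [Matrix.IsSymm, transpose_mul, transpose_mul, transpose_transpose, hsymm a, mul_assoc])
    (fun a b hab => by rw [hconj, htr, horth a b hab])
    (fun a => by rw [hconj, htr]; exact hnorm a)
  rw [hD] at key
  simpa only [hconj, ← sub_mul, ← mul_sub, htr] using key

variable [DecidableEq κ]

theorem sum_trace_orthogonal_mix {U : Matrix κ κ ℝ} (hU : U * Uᵀ = 1) (C : κ → Matrix ι ι ℝ) :
    ∑ b, trace ((∑ s, U s b • C s) * ∑ s, U s b • C s) = ∑ s, trace (C s * C s) := by
  have hUe : ∀ s t, ∑ b, U s b * U t b = if s = t then 1 else 0 := by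
    intro s t
    have := congrFun (congrFun hU s) t
    simpa only [mul_apply, transpose_apply, one_apply] using this
  calc _ = ∑ b, ∑ s, ∑ t, U s b * U t b * trace (C s * C t) := by
        refine sum_congr rfl fun b _ => ?_
        simp only [sum_mul, mul_sum, trace_sum, smul_mul_smul_comm, trace_smul, smul_eq_mul]
        exact sum_comm
    _ = ∑ s, ∑ t, (∑ b, U s b * U t b) * trace (C s * C t) := by
        rw [sum_comm]
        refine sum_congr rfl fun s _ => ?_
        rw [sum_comm]
        simp only [sum_mul]
    _ = _ := by simp [hUe]

theorem sum_mul_weight_le_sq_sum {x : κ → ℝ} {k : κ → κ → ℝ} (hx0 : ∀ a, 0 ≤ x a)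
    (hkc : ∀ a b, k a b = k b a) (hk0 : ∀ a, k a a = 0)
    (hrow : ∀ a, ∑ b, max (k a b - 1) 0 ≤ 1) :
    ∑ a, ∑ b, x a * x b * k a b ≤ (∑ a, x a) ^ 2 := by
  set w : κ → κ → ℝ := fun a b => max (k a b - 1) 0 with hw
  have hw0 : ∀ a b, 0 ≤ w a b := fun a b => le_max_right _ _
  have hterm : ∀ a b, x a * x b * k a b ≤ x a * x b -
      (if a = b then x a ^ 2 else 0) + (w a b * x a ^ 2 + w b a * x b ^ 2) / 2 := by
    intro a b
    have hwc : w b a = w a b := by simp only [hw, hkc b a]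
    split_ifs with hab
    · subst hab
      rw [hk0]
      nlinarith [hw0 a a, sq_nonneg (x a)]
    · have h1 : k a b - 1 ≤ w a b := le_max_left _ _
      rw [hwc]
      nlinarith [mul_le_mul_of_nonneg_left h1 (mul_nonneg (hx0 a) (hx0 b)),
        mul_nonneg (hw0 a b) (sq_nonneg (x a - x b))]
  have hW : ∑ a, ∑ b, w a b * x a ^ 2 ≤ ∑ a, x a ^ 2 := sum_le_sum fun a _ => by
    rw [← sum_mul]
    exact mul_le_of_le_one_left (sq_nonneg _) (hrow a)
  calc _ ≤ ∑ a, ∑ b, (x a * x b - (if a = b then x a ^ 2 else 0) +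
          (w a b * x a ^ 2 + w b a * x b ^ 2) / 2) :=
        sum_le_sum fun a _ => sum_le_sum fun b _ => hterm a b
    _ = (∑ a, x a) ^ 2 - ∑ a, x a ^ 2 + ∑ a, ∑ b, w a b * x a ^ 2 := by
        have hswap : ∑ a, ∑ b, w b a * x b ^ 2 = ∑ a, ∑ b, w a b * x a ^ 2 := sum_comm
        simp only [sum_add_distrib, sum_sub_distrib, ← sum_div, hswap, sum_ite_eq, mem_univ,
          if_true, sq (∑ a, x a), sum_mul_sum]
        ring
    _ ≤ _ := by linarith

/-- The DDVV inequality for pairwise orthogonal symmetric matrices. -/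
theorem ddvv_of_orthogonal {B : κ → Matrix ι ι ℝ} (hsymm : ∀ a, (B a).IsSymm)
    (horth : ∀ a b, a ≠ b → trace (B a * B b) = 0) :
    ∑ a, ∑ b, -trace ((B a * B b - B b * B a) * (B a * B b - B b * B a)) ≤
      (∑ a, trace (B a * B a)) ^ 2 := by
  set x : κ → ℝ := fun a => trace (B a * B a) with hx
  have hx0 : ∀ a, 0 ≤ x a := fun a => by
    simp only [hx]
    rw [(hsymm a).trace_mul_self]; positivity
  set Q : κ → Matrix ι ι ℝ := fun a => (√(x a))⁻¹ • B a with hQ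
  have hBQ : ∀ a, B a = √(x a) • Q a := by
    intro a
    rcases eq_or_ne (x a) 0 with h0 | h0
    · have h1 := h0
      simp only [hx] at h1
      rw [(hsymm a).trace_mul_self, sum_eq_zero_iff_of_nonneg (fun _ _ => by positivity)] at h1
      have : B a = 0 := by
        ext i j
        have h2 := h1 i (mem_univ i)
        rw [sum_eq_zero_iff_of_nonneg (fun _ _ => by positivity)] at h2
        exact pow_eq_zero_iff two_ne_zero |>.1 (h2 j (mem_univ j))
      simp [hQ, this]
    · rw [hQ, smul_smul, mul_inv_cancel₀ (Real.sqrt_ne_zero'.2 ((hx0 a).lt_of_ne' h0)), one_smul]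
  have hQs : ∀ a, (Q a).IsSymm := fun a => (hsymm a).smul _
  have hQo : ∀ a b, a ≠ b → trace (Q a * Q b) = 0 := fun a b hab => by
    simp [hQ, horth a b hab]
  have hQn : ∀ a, trace (Q a * Q a) ≤ 1 := fun a => by
    simp only [hQ, smul_mul_smul_comm, trace_smul, smul_eq_mul]
    rw [← mul_inv, Real.mul_self_sqrt (hx0 a)]
    exact inv_mul_le_one
  set k : κ → κ → ℝ := fun a b =>
    -trace ((Q a * Q b - Q b * Q a) * (Q a * Q b - Q b * Q a)) with hk
  have hkB : ∀ a b, -trace ((B a * B b - B b * B a) * (B a * B b - B b * B a)) =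
      x a * x b * k a b := by
    intro a b
    have hcomm : B a * B b - B b * B a = (√(x a) * √(x b)) • (Q a * Q b - Q b * Q a) := by
      conv_lhs => rw [hBQ a, hBQ b]
      rw [smul_mul_smul_comm √(x a), smul_mul_smul_comm √(x b), mul_comm √(x b), smul_sub]
    rw [hcomm, smul_mul_smul_comm, trace_smul, smul_eq_mul, mul_mul_mul_comm,
      Real.mul_self_sqrt (hx0 a), Real.mul_self_sqrt (hx0 b), hk]
    ring
  have hkc : ∀ a b, k a b = k b a := fun a b => by
    simp only [hk]
    rw [← neg_sub, neg_mul_neg]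
  simp only [hkB]
  exact sum_mul_weight_le_sq_sum hx0 hkc (fun a => by simp [hk]) fun a =>
    sum_excess_commutator_le (hQs a) (hQn a) hQs hQo hQn

/-- The **DDVV inequality** for families of symmetric matrices. -/
theorem ddvv {A : κ → Matrix ι ι ℝ} (hsymm : ∀ a, (A a).IsSymm) :
    ∑ a, ∑ b, -trace ((A a * A b - A b * A a) * (A a * A b - A b * A a)) ≤
      (∑ a, trace (A a * A a)) ^ 2 := by
  have hG : (Matrix.of fun a b => trace (A a * A b)).IsSymm := by
    ext a b
    simp [trace_mul_comm (A a)]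
  obtain ⟨U, d, hU, hU', hGd⟩ := hG.exists_orthogonal_diagonal
  set B : κ → Matrix ι ι ℝ := fun b => ∑ s, U s b • A s with hB
  have hBs : ∀ b, (B b).IsSymm := fun b => by
    rw [Matrix.IsSymm, hB, transpose_sum]
    exact sum_congr rfl fun s _ => by rw [transpose_smul, hsymm s]
  have hBo : ∀ a b, a ≠ b → trace (B a * B b) = 0 := by
    intro a b hab
    have hdiag : Uᵀ * (Matrix.of fun a b => trace (A a * A b)) * U = diagonal d := by
      rw [hGd]
      calc _ = (Uᵀ * U) * diagonal d * (Uᵀ * U) := by simp only [mul_assoc]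
        _ = _ := by rw [hU, one_mul, mul_one]
    have hentry := congrFun (congrFun hdiag a) b
    rw [diagonal_apply_ne _ hab] at hentry
    rw [← hentry]
    simp only [hB, mul_apply (M := _ * _), mul_apply (M := Uᵀ), transpose_apply, of_apply,
      sum_mul, mul_sum, trace_sum, smul_mul_smul_comm, trace_smul, smul_eq_mul]
    exact sum_congr rfl fun s _ => sum_congr rfl fun t _ => by ring
  have hmix : ∀ X : Matrix ι ι ℝ,
      ∑ b, trace ((X * B b - B b * X) * (X * B b - B b * X)) =
        ∑ s, trace ((X * A s - A s * X) * (X * A s - A s * X)) := by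
    intro X
    rw [← sum_trace_orthogonal_mix hU' fun s => X * A s - A s * X]
    refine sum_congr rfl fun b _ => ?_
    have : X * B b - B b * X = ∑ s, U s b • (X * A s - A s * X) := by
      simp only [hB, mul_sum, sum_mul, mul_smul_comm, smul_mul_assoc, smul_sub, sum_sub_distrib]
    rw [this]
  have hneg : ∀ X Y : Matrix ι ι ℝ, trace ((X * Y - Y * X) * (X * Y - Y * X)) =
      trace ((Y * X - X * Y) * (Y * X - X * Y)) := fun X Y => by
    rw [← neg_sub, neg_mul_neg]
  have hcomm : ∑ a, ∑ b, -trace ((A a * A b - A b * A a) * (A a * A b - A b * A a)) =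
      ∑ a, ∑ b, -trace ((B a * B b - B b * B a) * (B a * B b - B b * B a)) := by
    simp only [sum_neg_distrib, hmix]
    rw [sum_comm (f := fun a s => trace ((B a * A s - A s * B a) * (B a * A s - A s * B a)))]
    simp only [hneg (B _), hmix]
  rw [hcomm, ← sum_trace_orthogonal_mix hU' A]
  exact ddvv_of_orthogonal hBs hBo

end DDVV

theorem sum_lt_eq_half_sum {n : ℕ} {f : Fin n → Fin n → ℝ} (hsymm : ∀ i j, f i j = f j i)
    (hdiag : ∀ i, f i i = 0) :
    2 * ∑ i, ∑ j, (if i < j then f i j else 0) = ∑ i, ∑ j, f i j := by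
  have hswap : ∑ i, ∑ j, (if i < j then f i j else 0) = ∑ i, ∑ j, if j < i then f i j else 0 := by
    rw [sum_comm]
    exact sum_congr rfl fun i _ => sum_congr rfl fun j _ => by rw [hsymm]
  rw [two_mul]
  nth_rewrite 2 [hswap]
  simp only [← sum_add_distrib]
  refine sum_congr rfl fun i _ => sum_congr rfl fun j _ => ?_
  rcases lt_trichotomy i j with h | rfl | h
  · simp [h, h.asymm]
  · simp [hdiag]
  · simp [h, h.asymm]

theorem two_mul_scalarCurv_of_quasi_constant {n k : ℕ} {R : Fin n → Fin n → Fin n → Fin n → ℝ}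
    {h : Fin k → Matrix (Fin n) (Fin n) ℝ} (hsymm : ∀ r, (h r).IsSymm) {p q : ℝ} {φ : Fin n → ℝ}
    (hR : ∀ i j, R i j j i = p * (1 - kdelta i j)
      + q * (φ i ^ 2 + φ j ^ 2 - 2 * (kdelta i j * (φ i * φ j)))
      + ∑ r, (h r i i * h r j j - h r i j ^ 2)) :
    2 * scalarCurv R = p * (n * (n - 1)) + q * (2 * (n - 1) * ∑ i, φ i ^ 2)
      + ∑ r, (trace (h r) ^ 2 - trace (h r * h r)) := by
  have hcomm : ∀ i j : Fin n, kdelta i j = kdelta j i := fun i j => by simp [kdelta, eq_comm]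
  have hone : ∀ i : Fin n, kdelta i i = 1 := fun i => by simp [kdelta]
  have hnormal : ∀ r, ∑ i, ∑ j, (h r i i * h r j j - h r i j ^ 2) =
      trace (h r) ^ 2 - trace (h r * h r) := fun r => by
    rw [(hsymm r).trace_mul_self]
    simp only [sum_sub_distrib, ← sum_mul_sum, trace, diag_apply, sq]
  have hp : ∑ i : Fin n, ∑ j : Fin n, (1 - kdelta i j) = (n * (n - 1) : ℝ) := by
    simp [kdelta]; ring
  have hq : ∑ i, ∑ j, (φ i ^ 2 + φ j ^ 2 - 2 * (kdelta i j * (φ i * φ j))) =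
      2 * (n - 1) * ∑ i, φ i ^ 2 := by
    simp only [sum_add_distrib, sum_sub_distrib, ← mul_sum, kdelta, ite_mul, one_mul, zero_mul,
      sum_ite_eq, mem_univ, if_true, sum_const, card_univ, Fintype.card_fin, nsmul_eq_mul, ← sq]
    ring
  rw [scalarCurv, sum_lt_eq_half_sum (f := fun i j => R i j j i)]
  · simp only [hR, sum_add_distrib, ← mul_sum, hp, hq, ← hnormal]
    congr 1
    rw [sum_comm (s := (univ : Finset (Fin k)))]
    exact sum_congr rfl fun i _ => sum_comm
  · intro i j
    rw [hR i j, hR j i, hcomm j i]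
    congr 1
    · ring
    · exact sum_congr rfl fun r _ => by rw [(hsymm r).apply i j]; ring
  · intro i
    rw [hR, hone, sum_eq_zero fun r _ => by ring]
    ring

theorem two_mul_sqrt_KN_le {n k : ℕ} (hn : n ≠ 0) {h : Fin k → Matrix (Fin n) (Fin n) ℝ}
    (hsymm : ∀ r, (h r).IsSymm) :
    2 * √(KN h) ≤ ∑ r, (trace (h r * h r) - trace (h r) ^ 2 / n) := by
  set B : Fin k → Matrix (Fin n) (Fin n) ℝ := fun r => h r - (trace (h r) / n) • 1 with hB
  have hBs : ∀ r, (B r).IsSymm := fun r => (hsymm r).sub (isSymm_one.smul _)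
  have hcomm : ∀ r s, B r * B s - B s * B r = h r * h s - h s * h r := fun r s => by
    simp only [hB, sub_mul, mul_sub, smul_mul_assoc, mul_smul_comm, one_mul, mul_one]
    module
  have htr : ∀ r, trace (B r * B r) = trace (h r * h r) - trace (h r) ^ 2 / n := fun r => by
    simp only [hB, sub_mul, mul_sub, smul_mul_assoc, mul_smul_comm, one_mul, mul_one, trace_sub,
      trace_smul, trace_one, Fintype.card_fin, smul_eq_mul]
    field_simp
    ring
  have hddvv := ddvv hBs
  simp only [hcomm, htr] at hddvv
  have hnonneg : 0 ≤ ∑ r, (trace (h r * h r) - trace (h r) ^ 2 / n) :=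
    sum_nonneg fun r _ => by rw [← htr, (hBs r).trace_mul_self]; positivity
  have hKN : KN h ≤ ((∑ r, (trace (h r * h r) - trace (h r) ^ 2 / n)) / 2) ^ 2 := by
    simp only [sum_neg_distrib] at hddvv
    rw [KN]
    linarith
  linarith [Real.sqrt_le_iff.2 ⟨by linarith, hKN⟩]

theorem normScalarCurv_add_rhoN_le {n k : ℕ} (hn : 2 ≤ n) {R : Fin n → Fin n → Fin n → Fin n → ℝ}
    {h : Fin k → Matrix (Fin n) (Fin n) ℝ} (hsymm : ∀ r, (h r).IsSymm) {p q : ℝ} {φ : Fin n → ℝ}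
    (hR : ∀ i j, R i j j i = p * (1 - kdelta i j)
      + q * (φ i ^ 2 + φ j ^ 2 - 2 * (kdelta i j * (φ i * φ j)))
      + ∑ r, (h r i i * h r j j - h r i j ^ 2)) :
    normScalarCurv R + rhoN h ≤ meanCurvSq h + p + 2 * q / n * ∑ i, φ i ^ 2 := by
  have hn' : (2 : ℝ) ≤ n := by exact_mod_cast hn
  have hn0 : (n : ℝ) ≠ 0 := by positivity
  have hn1 : (n : ℝ) - 1 ≠ 0 := by linarith
  have hpos : 0 < (n : ℝ) * (n - 1) := mul_pos (by linarith) (by linarith)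
  have hH : meanCurvSq h = (∑ r, trace (h r) ^ 2) / n ^ 2 := by
    rw [meanCurvSq, sum_div]
    exact sum_congr rfl fun r _ => by simp only [trace, diag_apply]; ring
  have hK := two_mul_sqrt_KN_le (by omega) hsymm
  rw [sum_sub_distrib, ← sum_div] at hK
  rw [normScalarCurv, rhoN, two_mul_scalarCurv_of_quasi_constant hsymm hR, hH, sum_sub_distrib,
    div_mul_eq_mul_div, ← add_div, div_le_iff₀ hpos]
  refine (add_le_add_right hK _).trans_eq ?_
  field_simp
  ring

/-- **Generalized Wintgen inequality in a manifold of quasi-constant curvature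
(`ρ_N` version, tangent / normal cases).**  If the distinguished unit vector field `V`
is everywhere tangent to the submanifold (all its normal components vanish), then
`ρ + ρ_N ≤ ‖H‖² + p + 2q/n`; if `V` is everywhere normal to the submanifold (all its
tangential components vanish), then `ρ + ρ_N ≤ ‖H‖² + p`. -/
theorem wintgen_rhoN_quasi_constant_tangent_normal {n m : ℕ}
    (hn : 3 ≤ n) (hm : 4 ≤ m) (hnm : n ≤ m)
    (Rt : Fin m → Fin m → Fin m → Fin m → ℝ)
    (R : Fin n → Fin n → Fin n → Fin n → ℝ)
    (h : Fin (m - n) → Matrix (Fin n) (Fin n) ℝ)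
    (hsymm : ∀ r, (h r).IsSymm)
    (p q : ℝ) (ψ : Fin m → ℝ) (hψ : ∑ x : Fin m, ψ x ^ 2 = 1)
    (quasi : ∀ x y z w : Fin m, Rt x y z w =
      p * (kdelta y z * kdelta x w - kdelta x z * kdelta y w)
      + q * (kdelta x w * ψ y * ψ z - kdelta x z * ψ y * ψ w
          + kdelta y z * ψ x * ψ w - kdelta y w * ψ x * ψ z))
    (gauss : ∀ i j k l : Fin n, R i j k l =
      Rt (Fin.castLE hnm i) (Fin.castLE hnm j) (Fin.castLE hnm k) (Fin.castLE hnm l)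
      + ∑ r : Fin (m - n), (h r i l * h r j k - h r i k * h r j l)) :
    ((∀ x : Fin m, n ≤ (x : ℕ) → ψ x = 0) →
      normScalarCurv R + rhoN h ≤ meanCurvSq h + p + 2 * q / (n : ℝ)) ∧
    ((∀ j : Fin n, ψ (Fin.castLE hnm j) = 0) →
      normScalarCurv R + rhoN h ≤ meanCurvSq h + p) := by
  have hinj : Function.Injective (Fin.castLE hnm) := Fin.castLE_injective hnm
  have key := normScalarCurv_add_rhoN_le (by omega) (p := p) (q := q)
    (φ := fun i => ψ (Fin.castLE hnm i)) hsymm (R := R) fun i j => by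
      have hk : kdelta (Fin.castLE hnm i) (Fin.castLE hnm j) = kdelta i j := by
        simp [kdelta, hinj.eq_iff]
      have hk' : kdelta (Fin.castLE hnm j) (Fin.castLE hnm i) = kdelta i j := by
        simp [kdelta, hinj.eq_iff, eq_comm]
      have hone : ∀ x : Fin m, kdelta x x = 1 := fun x => by simp [kdelta]
      have hsq : kdelta i j * kdelta i j = kdelta i j := by simp [kdelta]
      rw [gauss, quasi, hone, hone, hk, hk', hsq]
      congr 1
      · ring
      · exact sum_congr rfl fun r _ => by rw [(hsymm r).apply i j]; ring
  constructor
  · intro htan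
    have hsum : ∑ i, ψ (Fin.castLE hnm i) ^ 2 = 1 := by
      rw [← hψ]
      refine Fintype.sum_of_injective _ hinj _ _ (fun x hx => ?_) fun _ => rfl
      rw [htan x (by_contra fun hlt => hx ⟨⟨x, not_le.1 hlt⟩, rfl⟩)]
      norm_num
    simpa only [hsum, mul_one] using key
  · intro hnor
    simpa [hnor] using key
end

section
/- Let $M^n$, $n \geq 3$, be an $n$-dimensional submanifold of an $m$-dimensional, $m \geq 4$, Riemannian manifold of quasi-constant curvature $(\widetilde{M}^m, \widetilde{g})$ with associated functions $p, q$ and distinguished unit vector field $V$. If $V$ is everywhere tangent to $M^n$, then $\rho + \rho^{\perp} \leq \Vert H \Vert^2 + p + \frac{2q}{n}$, and if $V$ is everywhere normal to $M^n$, then $\rho + \rho^{\perp} \leq \Vert H \Vert^2 + p$. -/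
open Finset Matrix

/-- The squared Frobenius norm of a real matrix. -/
def frobSq {κ : Type*} [Fintype κ] (X : Matrix κ κ ℝ) : ℝ := ∑ i, ∑ j, X i j ^ 2

section Spread
variable {κ : Type*} [Fintype κ]

lemma sum_sq_subset_le (l : κ → ℝ) (s : Finset κ) : ∑ i ∈ s, l i ^ 2 ≤ ∑ i, l i ^ 2 :=
  sum_le_sum_of_subset_of_nonneg (subset_univ s) fun _ _ _ => sq_nonneg _

/-- Two pairs of entries whose squared gap exceeds the total sum of squares share an index. -/
lemma large_gaps_not_disjoint [DecidableEq κ] (l : κ → ℝ) {a b c d : κ}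
    (hab : ∑ i, l i ^ 2 < (l a - l b) ^ 2) (hcd : ∑ i, l i ^ 2 < (l c - l d) ^ 2)
    (hac : a ≠ c) (had : a ≠ d) (hbc : b ≠ c) (hbd : b ≠ d) : False := by
  have hg : 0 ≤ ∑ i, l i ^ 2 := sum_nonneg fun _ _ => sq_nonneg _
  have h1 : a ≠ b := by rintro rfl; simp at hab; linarith
  have h2 : c ≠ d := by rintro rfl; simp at hcd; linarith
  have h := sum_sq_subset_le l {a, b, c, d}
  rw [sum_insert (by simp [*]), sum_insert (by simp [*]), sum_insert (by simp [*]),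
    sum_singleton] at h
  nlinarith [sq_nonneg (l a + l b), sq_nonneg (l c + l d)]

/-- Pairs of entries whose squared gap exceeds the total sum of squares do not form a triangle. -/
lemma large_gaps_no_triangle [DecidableEq κ] (l : κ → ℝ) {a b c : κ}
    (hab : ∑ i, l i ^ 2 < (l a - l b) ^ 2) (hbc : ∑ i, l i ^ 2 < (l b - l c) ^ 2)
    (hac : ∑ i, l i ^ 2 < (l a - l c) ^ 2) : False := by
  have hg : 0 ≤ ∑ i, l i ^ 2 := sum_nonneg fun _ _ => sq_nonneg _
  have h1 : a ≠ b := by rintro rfl; simp at hab; linarith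
  have h2 : b ≠ c := by rintro rfl; simp at hbc; linarith
  have h3 : a ≠ c := by rintro rfl; simp at hac; linarith
  have h := sum_sq_subset_le l {a, b, c}
  rw [sum_insert (by simp [*]), sum_insert (by simp [*]), sum_singleton] at h
  nlinarith [sq_nonneg (l a + l b + l c)]

/-- All pairs of entries whose squared gap exceeds the total sum of squares share one index. -/
lemma large_gaps_star [Nonempty κ] (l : κ → ℝ) :
    ∃ a, ∀ i j, ∑ k, l k ^ 2 < (l i - l j) ^ 2 → i = a ∨ j = a := by
  classical
  have hs : ∀ i j, (l i - l j) ^ 2 = (l j - l i) ^ 2 := fun i j => by ring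
  by_contra! hcon
  obtain ⟨a, b, hab, -, -⟩ := hcon (Classical.arbitrary κ)
  obtain ⟨e, hbe, hea⟩ : ∃ e, ∑ k, l k ^ 2 < (l b - l e) ^ 2 ∧ e ≠ a := by
    obtain ⟨c, d, hcd, hc, hd⟩ := hcon a
    by_cases hcb : c = b
    · exact ⟨d, hcb ▸ hcd, hd⟩
    by_cases hdb : d = b
    · exact ⟨c, by rw [hs]; exact hdb ▸ hcd, hc⟩
    exact (large_gaps_not_disjoint l hab hcd hc.symm hd.symm (Ne.symm hcb) (Ne.symm hdb)).elim
  obtain ⟨f, haf, hfb⟩ : ∃ f, ∑ k, l k ^ 2 < (l a - l f) ^ 2 ∧ f ≠ b := by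
    obtain ⟨c, d, hcd, hc, hd⟩ := hcon b
    by_cases hca : c = a
    · exact ⟨d, hca ▸ hcd, hd⟩
    by_cases hda : d = a
    · exact ⟨c, by rw [hs]; exact hda ▸ hcd, hc⟩
    exact (large_gaps_not_disjoint l hab hcd (Ne.symm hca) (Ne.symm hda) hc.symm hd.symm).elim
  have hg : 0 ≤ ∑ i, l i ^ 2 := sum_nonneg fun _ _ => sq_nonneg _
  have hne : a ≠ b := by rintro rfl; simp at hab; linarith
  by_cases hef : e = f
  · subst hef
    exact large_gaps_no_triangle l hab hbe haf
  · exact large_gaps_not_disjoint l hbe haf hne.symm hfb.symm hea hef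

/-- The excesses of the squared gaps from one index add up to at most the sum of squares. -/
lemma sum_gap_excess_from_le (l : κ → ℝ) (a : κ) :
    ∑ j, max ((l a - l j) ^ 2 - ∑ k, l k ^ 2) 0 ≤ ∑ k, l k ^ 2 := by
  classical
  set g := ∑ k, l k ^ 2 with hgdef
  have hg : 0 ≤ g := sum_nonneg fun _ _ => sq_nonneg _
  set J := univ.filter fun j => g < (l a - l j) ^ 2 with hJ
  have haJ : a ∉ J := by simp [hJ, hg]
  have hsum : ∑ j, max ((l a - l j) ^ 2 - g) 0 = ∑ j ∈ J, ((l a - l j) ^ 2 - g) := by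
    rw [hJ, sum_filter]
    refine sum_congr rfl fun j _ => ?_
    split_ifs with h
    · exact max_eq_left (by linarith)
    · exact max_eq_right (by linarith)
  have hexp : ∑ j ∈ J, ((l a - l j) ^ 2 - g)
      = (J.card : ℝ) * l a ^ 2 - 2 * l a * ∑ j ∈ J, l j + ∑ j ∈ J, l j ^ 2 - J.card * g := by
    simp only [sub_sq, sum_sub_distrib, sum_add_distrib, ← mul_sum, sum_const, nsmul_eq_mul]
  have hQ := sum_sq_subset_le l (insert a J)
  rw [sum_insert haJ, ← hgdef] at hQ
  have hS := sq_sum_le_card_mul_sum_sq (s := J) (f := l)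
  have hk : (0 : ℝ) ≤ J.card := Nat.cast_nonneg _
  rw [hsum, hexp]
  nlinarith [mul_le_mul_of_nonneg_left hQ hk, sq_nonneg (∑ j ∈ J, l j + l a)]

/-- The excesses of all squared gaps add up to at most the sum of squares, each unordered pair
counted twice. -/
lemma sum_gap_excess_le (l : κ → ℝ) :
    ∑ i, ∑ j, max ((l i - l j) ^ 2 - ∑ k, l k ^ 2) 0 ≤ 2 * ∑ k, l k ^ 2 := by
  classical
  rcases isEmpty_or_nonempty κ with hκ | hκ
  · simp
  obtain ⟨a, ha⟩ := large_gaps_star l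
  have hle := sum_gap_excess_from_le l a
  set g := ∑ k, l k ^ 2 with hgdef
  have hpt : ∀ i j, max ((l i - l j) ^ 2 - g) 0 ≤
      (if i = a then max ((l a - l j) ^ 2 - g) 0 else 0)
        + (if j = a then max ((l a - l i) ^ 2 - g) 0 else 0) := by
    intro i j
    have h0 : ∀ x : ℝ, 0 ≤ max x 0 := fun x => le_max_right _ _
    by_cases hi : i = a
    · subst hi
      simp only [if_true]
      have : 0 ≤ if j = i then max ((l i - l i) ^ 2 - g) 0 else 0 := by
        split_ifs <;> simp
      linarith
    · by_cases hj : j = a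
      · subst hj
        simp only [if_true, hi, if_false, zero_add]
        rw [show (l i - l j) ^ 2 = (l j - l i) ^ 2 by ring]
      · have : (l i - l j) ^ 2 ≤ g := by
          by_contra! h
          rcases ha i j h with h | h
          · exact hi h
          · exact hj h
        simp only [hi, hj, if_false, add_zero]
        exact max_le (by linarith) le_rfl
  calc _ ≤ ∑ i, ∑ j, ((if i = a then max ((l a - l j) ^ 2 - g) 0 else 0)
        + (if j = a then max ((l a - l i) ^ 2 - g) 0 else 0)) :=
        sum_le_sum fun i _ => sum_le_sum fun j _ => hpt i j
    _ = 2 * ∑ j, max ((l a - l j) ^ 2 - g) 0 := by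
        simp only [sum_add_distrib]
        rw [sum_comm]
        simp [two_mul]
    _ ≤ _ := by linarith

end Spread

section Commutator
variable {ι κ : Type*} [Fintype ι] [Fintype κ] [DecidableEq κ]

lemma sum_smul_apply {ι κ : Type*} [Fintype ι] (w : ι → ℝ) (A : ι → Matrix κ κ ℝ) (i j : κ) :
    (∑ b, w b • A b) i j = ∑ b, w b * A b i j := by
  simp [Matrix.sum_apply]

/-- The commutator bound when the distinguished combination is diagonal. -/
lemma sum_frobSq_commutator_diagonal_le (A : ι → Matrix κ κ ℝ) (hA : ∀ b, (A b).IsSymm)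
    (v : ι → ℝ) (hv : ∑ b, v b ^ 2 = 1) (l : κ → ℝ) (hB : ∑ b, v b • A b = diagonal l)
    (hmax : ∀ w : ι → ℝ, frobSq (∑ b, w b • A b) ≤ (∑ k, l k ^ 2) * ∑ b, w b ^ 2) :
    ∑ b, frobSq (diagonal l * A b - A b * diagonal l)
      ≤ (∑ k, l k ^ 2) * ∑ b, frobSq (A b) := by
  set g := ∑ k, l k ^ 2 with hgdef
  have hg : 0 ≤ g := sum_nonneg fun _ _ => sq_nonneg _
  set W : κ → κ → ℝ := fun i j => ∑ b, A b i j ^ 2 with hW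
  have hW0 : ∀ i j, 0 ≤ W i j := fun i j => sum_nonneg fun _ _ => sq_nonneg _
  have hoff : ∀ i j, i ≠ j → W i j ≤ g / 2 := by
    intro i j hij
    have h1 := hmax fun b => A b i j
    set Y := ∑ b, A b i j • A b with hY
    have hYij : Y i j = W i j := by
      rw [hY, sum_smul_apply]
      exact sum_congr rfl fun b _ => by ring
    have hYji : Y j i = W i j := by
      rw [hY, sum_smul_apply]
      exact sum_congr rfl fun b _ => by rw [(hA b).apply i j]; ring
    have h2 : Y i j ^ 2 + Y j i ^ 2 ≤ frobSq Y := by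
      have hrow : ∀ a b, Y a b ^ 2 ≤ ∑ c, Y a c ^ 2 := fun a b =>
        single_le_sum (f := fun c => Y a c ^ 2) (fun _ _ => sq_nonneg _) (mem_univ b)
      have : ∑ a ∈ {i, j}, ∑ c, Y a c ^ 2 ≤ frobSq Y :=
        sum_le_sum_of_subset_of_nonneg (subset_univ _)
          fun _ _ _ => sum_nonneg fun _ _ => sq_nonneg _
      rw [sum_pair hij] at this
      linarith [hrow i j, hrow j i]
    rw [hYij, hYji] at h2
    change frobSq Y ≤ g * W i j at h1
    by_contra! hlt
    nlinarith [hW0 i j]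
  have hdiag : g ≤ ∑ i, W i i := by
    refine sum_le_sum fun i _ => ?_
    have h1 : l i = ∑ b, v b * A b i i := by
      rw [← sum_smul_apply, hB, diagonal_apply_eq]
    have h2 := sum_mul_sq_le_sq_mul_sq univ v fun b => A b i i
    rw [hv, one_mul] at h2
    rw [h1]
    exact h2
  have hL : ∑ b, frobSq (diagonal l * A b - A b * diagonal l)
      = ∑ i, ∑ j, (l i - l j) ^ 2 * W i j := by
    simp only [frobSq, Matrix.sub_apply, diagonal_mul, mul_diagonal]
    rw [sum_comm]
    refine sum_congr rfl fun i _ => ?_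
    rw [sum_comm]
    refine sum_congr rfl fun j _ => ?_
    rw [hW, mul_sum]
    exact sum_congr rfl fun b _ => by ring
  have hN : ∑ b, frobSq (A b) = ∑ i, ∑ j, W i j := by
    simp only [frobSq, hW]
    rw [sum_comm]
    exact sum_congr rfl fun i _ => sum_comm
  have hpt : ∀ i j, ((l i - l j) ^ 2 - g) * W i j ≤
      max ((l i - l j) ^ 2 - g) 0 * (g / 2) - if i = j then g * W i i else 0 := by
    intro i j
    by_cases hij : i = j
    · subst hij
      have : 0 ≤ max ((l i - l i) ^ 2 - g) 0 * (g / 2) := by positivity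
      simp only [if_true]
      nlinarith
    · simp only [hij, if_false, sub_zero]
      exact (mul_le_mul_of_nonneg_right (le_max_left _ 0) (hW0 i j)).trans
        (mul_le_mul_of_nonneg_left (hoff i j hij) (le_max_right _ _))
  have hsum : ∑ i, ∑ j, ((l i - l j) ^ 2 - g) * W i j ≤ 0 := by
    calc _ ≤ ∑ i, ∑ j, (max ((l i - l j) ^ 2 - g) 0 * (g / 2)
            - if i = j then g * W i i else 0) :=
          sum_le_sum fun i _ => sum_le_sum fun j _ => hpt i j
      _ = (∑ i, ∑ j, max ((l i - l j) ^ 2 - g) 0) * (g / 2) - g * ∑ i, W i i := by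
          simp [sum_sub_distrib, ← sum_mul, mul_sum]
      _ ≤ 0 := by
          have := mul_le_mul_of_nonneg_right (sum_gap_excess_le l) (show 0 ≤ g / 2 by linarith)
          nlinarith [mul_le_mul_of_nonneg_left hdiag hg]
  rw [hL, hN]
  simp only [sub_mul, sum_sub_distrib, ← mul_sum] at hsum
  linarith

lemma frobSq_eq_trace {κ : Type*} [Fintype κ] (X : Matrix κ κ ℝ) : frobSq X = trace (Xᵀ * X) := by
  simp only [frobSq, trace, Matrix.diag, Matrix.mul_apply, transpose_apply]
  rw [sum_comm]
  exact sum_congr rfl fun _ _ => sum_congr rfl fun _ _ => by ring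

lemma frobSq_conj {U : Matrix κ κ ℝ} (hU : U * Uᵀ = 1) (X : Matrix κ κ ℝ) :
    frobSq (Uᵀ * X * U) = frobSq X := by
  rw [frobSq_eq_trace, frobSq_eq_trace]
  have : (Uᵀ * X * U)ᵀ * (Uᵀ * X * U) = Uᵀ * (Xᵀ * (U * Uᵀ) * X * U) := by
    simp only [transpose_mul, transpose_transpose, Matrix.mul_assoc]
  rw [this, hU, Matrix.mul_one, trace_mul_comm, Matrix.mul_assoc, hU, Matrix.mul_one]

/-- If `B` is a unit combination of the symmetric matrices `A b` of maximal Frobenius norm, then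
`∑ b, ‖[B, A b]‖² ≤ ‖B‖² ∑ b, ‖A b‖²`. -/
lemma sum_frobSq_commutator_le (A : ι → Matrix κ κ ℝ) (hA : ∀ b, (A b).IsSymm)
    (v : ι → ℝ) (hv : ∑ b, v b ^ 2 = 1) (B : Matrix κ κ ℝ) (hB : B = ∑ b, v b • A b)
    (hmax : ∀ w : ι → ℝ, frobSq (∑ b, w b • A b) ≤ frobSq B * ∑ b, w b ^ 2) :
    ∑ b, frobSq (B * A b - A b * B) ≤ frobSq B * ∑ b, frobSq (A b) := by
  have hBs : B.IsHermitian := by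
    rw [IsHermitian, conjTranspose_eq_transpose_of_trivial, hB, transpose_sum]
    exact sum_congr rfl fun b _ => by rw [transpose_smul, (hA b).eq]
  set U : Matrix κ κ ℝ := (hBs.eigenvectorUnitary : Matrix κ κ ℝ)
  set l := hBs.eigenvalues
  have hU : U * Uᵀ = 1 := by
    have := Unitary.coe_mul_star_self hBs.eigenvectorUnitary
    rwa [Unitary.coe_star, star_eq_conjTranspose, conjTranspose_eq_transpose_of_trivial] at this
  have hU' : Uᵀ * U = 1 := mul_eq_one_comm.mp hU
  have hdiag : Uᵀ * B * U = diagonal l := by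
    have h := hBs.spectral_theorem
    have h' : B = U * diagonal l * Uᵀ := by
      conv_lhs => rw [h]
      simp [Unitary.conjStarAlgAut_apply, star_eq_conjTranspose, U, l]
    calc Uᵀ * B * U = (Uᵀ * U) * diagonal l * (Uᵀ * U) := by
          conv_lhs => rw [h']
          simp only [Matrix.mul_assoc]
      _ = diagonal l := by simp [hU']
  have hsq : frobSq B = ∑ k, l k ^ 2 := by
    rw [← frobSq_conj hU, hdiag]
    simp [frobSq, diagonal_apply, ite_pow]
  have hconj : ∀ w : ι → ℝ, ∑ b, w b • (Uᵀ * A b * U) = Uᵀ * (∑ b, w b • A b) * U := by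
    intro w
    simp [Matrix.mul_sum, Matrix.sum_mul]
  have key := sum_frobSq_commutator_diagonal_le (fun b => Uᵀ * A b * U)
    (fun b => by
      rw [IsSymm, transpose_mul, transpose_mul, transpose_transpose, (hA b).eq, Matrix.mul_assoc])
    v hv l (by rw [hconj, ← hB, hdiag])
    (fun w => by rw [hconj, frobSq_conj hU, ← hsq]; exact hmax w)
  simp only [frobSq_conj hU, ← hsq] at key
  refine le_of_eq_of_le (sum_congr rfl fun b _ => ?_) key
  rw [← hdiag, ← frobSq_conj hU]
  congr 1
  have h1 : Uᵀ * B * U * (Uᵀ * A b * U) = Uᵀ * (B * ((U * Uᵀ) * A b)) * U := by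
    simp only [Matrix.mul_assoc]
  have h2 : Uᵀ * A b * U * (Uᵀ * B * U) = Uᵀ * (A b * ((U * Uᵀ) * B)) * U := by
    simp only [Matrix.mul_assoc]
  rw [h1, h2, hU, Matrix.one_mul, Matrix.one_mul, Matrix.mul_sub, Matrix.sub_mul]

end Commutator

section Wintgen
variable {ι κ : Type*} [Fintype ι] [Fintype κ]

/-- The Frobenius inner product of real matrices. -/
def frobInner (X Y : Matrix κ κ ℝ) : ℝ := ∑ i, ∑ j, X i j * Y i j

lemma frobSq_eq_frobInner (X : Matrix κ κ ℝ) : frobSq X = frobInner X X := by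
  simp only [frobSq, frobInner, sq]

lemma frobSq_nonneg (X : Matrix κ κ ℝ) : 0 ≤ frobSq X :=
  sum_nonneg fun _ _ => sum_nonneg fun _ _ => sq_nonneg _

lemma frobSq_smul (r : ℝ) (X : Matrix κ κ ℝ) : frobSq (r • X) = r ^ 2 * frobSq X := by
  simp only [frobSq, mul_sum, Matrix.smul_apply, smul_eq_mul, mul_pow]

lemma frobSq_eq_zero {X : Matrix κ κ ℝ} (h : frobSq X = 0) : X = 0 := by
  ext i j
  have h1 := (sum_eq_zero_iff_of_nonneg
    fun i _ => sum_nonneg fun j _ => sq_nonneg (X i j)).mp h i (mem_univ i)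
  have h2 := (sum_eq_zero_iff_of_nonneg fun j _ => sq_nonneg (X i j)).mp h1 j (mem_univ j)
  simpa using h2

lemma frobSq_add_smul (t : ℝ) (X Y : Matrix κ κ ℝ) :
    frobSq (X + t • Y) = frobSq X + 2 * t * frobInner X Y + t ^ 2 * frobSq Y := by
  simp only [frobSq, frobInner, mul_sum, ← sum_add_distrib, Matrix.add_apply, Matrix.smul_apply,
    smul_eq_mul]
  exact sum_congr rfl fun _ _ => sum_congr rfl fun _ _ => by ring

lemma frobInner_smul_right (r : ℝ) (X Y : Matrix κ κ ℝ) :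
    frobInner X (r • Y) = r * frobInner X Y := by
  simp only [frobInner, mul_sum, Matrix.smul_apply, smul_eq_mul]
  exact sum_congr rfl fun _ _ => sum_congr rfl fun _ _ => by ring

lemma frobInner_add_right (X Y Z : Matrix κ κ ℝ) :
    frobInner X (Y + Z) = frobInner X Y + frobInner X Z := by
  simp only [frobInner, ← sum_add_distrib, Matrix.add_apply, mul_add]

lemma frobInner_neg_neg (X Y : Matrix κ κ ℝ) : frobInner (-X) (-Y) = frobInner X Y := by
  simp [frobInner]

lemma sum_mul_frobInner (w : ι → ℝ) (X : ι → Matrix κ κ ℝ) (Y : Matrix κ κ ℝ) :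
    ∑ b, w b * frobInner (X b) Y = frobInner (∑ b, w b • X b) Y := by
  simp only [frobInner, sum_smul_apply, mul_sum, sum_mul]
  rw [sum_comm]
  refine sum_congr rfl fun i _ => ?_
  rw [sum_comm]
  exact sum_congr rfl fun _ _ => sum_congr rfl fun _ _ => by ring

/-- The total squared Frobenius norm of all commutators of a family of matrices. -/
def commSq (A : ι → Matrix κ κ ℝ) : ℝ := ∑ a, ∑ b, frobSq (A a * A b - A b * A a)

lemma commSq_smul (r : ℝ) (A : ι → Matrix κ κ ℝ) :
    commSq (fun b => r • A b) = r ^ 4 * commSq A := by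
  simp only [commSq, mul_sum]
  refine sum_congr rfl fun a _ => sum_congr rfl fun b _ => ?_
  rw [smul_mul_smul_comm, smul_mul_smul_comm, ← smul_sub, frobSq_smul]
  ring

/-- Expansion of `commSq` along the variation `A a + t v a B` with `B = ∑ b, v b A b`, dropping
the nonnegative second-order term. -/
lemma le_commSq_variation (A : ι → Matrix κ κ ℝ) (v : ι → ℝ) (B : Matrix κ κ ℝ)
    (hB : B = ∑ b, v b • A b) (t : ℝ) :
    commSq A + 4 * t * ∑ b, frobSq (B * A b - A b * B)
      ≤ commSq (fun a => A a + t • v a • B) := by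
  set E : ι → ι → Matrix κ κ ℝ := fun a b =>
    v b • (A a * B - B * A a) + v a • (B * A b - A b * B) with hE
  have hC : ∀ a b, (A a + t • v a • B) * (A b + t • v b • B)
      - (A b + t • v b • B) * (A a + t • v a • B) = (A a * A b - A b * A a) + t • E a b := by
    intro a b
    simp only [hE, Matrix.add_mul, Matrix.mul_add, smul_mul_assoc, mul_smul_comm]
    module
  have hright : ∑ a, ∑ b, v a * frobInner (A a * A b - A b * A a) (B * A b - A b * B)
      = ∑ b, frobSq (B * A b - A b * B) := by
    rw [sum_comm]
    refine sum_congr rfl fun b _ => ?_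
    rw [sum_mul_frobInner, frobSq_eq_frobInner]
    congr 1
    rw [hB, Matrix.sum_mul, Matrix.mul_sum, ← sum_sub_distrib]
    exact sum_congr rfl fun a _ => by rw [smul_sub, smul_mul_assoc, mul_smul_comm]
  have hleft : ∑ a, ∑ b, v b * frobInner (A a * A b - A b * A a) (A a * B - B * A a)
      = ∑ b, frobSq (B * A b - A b * B) := by
    rw [← hright, sum_comm]
    refine sum_congr rfl fun a _ => sum_congr rfl fun b _ => ?_
    rw [← frobInner_neg_neg, neg_sub, neg_sub]
  have hin : ∑ a, ∑ b, frobInner (A a * A b - A b * A a) (E a b)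
      = 2 * ∑ b, frobSq (B * A b - A b * B) := by
    simp only [hE, frobInner_add_right, frobInner_smul_right, sum_add_distrib]
    rw [hleft, hright]
    ring
  have hexp : commSq (fun a => A a + t • v a • B)
      = commSq A + 2 * t * ∑ a, ∑ b, frobInner (A a * A b - A b * A a) (E a b)
        + t ^ 2 * ∑ a, ∑ b, frobSq (E a b) := by
    simp only [commSq, hC, frobSq_add_smul, sum_add_distrib, mul_sum]
  have hE0 : 0 ≤ ∑ a, ∑ b, frobSq (E a b) :=
    sum_nonneg fun _ _ => sum_nonneg fun _ _ => frobSq_nonneg _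
  rw [hexp, hin]
  nlinarith [mul_nonneg (sq_nonneg t) hE0]

lemma sum_frobSq_variation (A : ι → Matrix κ κ ℝ) (v : ι → ℝ) (hv : ∑ b, v b ^ 2 = 1)
    (B : Matrix κ κ ℝ) (hB : B = ∑ b, v b • A b) (t : ℝ) :
    ∑ a, frobSq (A a + t • v a • B)
      = ∑ a, frobSq (A a) + 2 * t * frobSq B + t ^ 2 * frobSq B := by
  simp only [frobSq_add_smul, frobInner_smul_right, frobSq_smul, sum_add_distrib, ← mul_sum,
    ← sum_mul, hv, one_mul]
  rw [sum_mul_frobInner, ← hB, ← frobSq_eq_frobInner]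

/-- Among the unit combinations of a nonempty family of matrices there is a longest one. -/
lemma exists_longest_combination [Nonempty ι] (A : ι → Matrix κ κ ℝ) :
    ∃ v : ι → ℝ, ∑ b, v b ^ 2 = 1 ∧ ∀ w : ι → ℝ,
      frobSq (∑ b, w b • A b) ≤ frobSq (∑ b, v b • A b) * ∑ b, w b ^ 2 := by
  classical
  have hcomp : IsCompact {v : ι → ℝ | ∑ b, v b ^ 2 = 1} := by
    refine (isCompact_Icc (a := fun _ => (-1 : ℝ)) (b := fun _ => 1)).of_isClosed_subset
      (isClosed_eq (by fun_prop) continuous_const) fun v hv => ?_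
    have hle : ∀ b, v b ^ 2 ≤ 1 := fun b => by
      rw [← show ∑ b, v b ^ 2 = 1 from hv]
      exact single_le_sum (f := fun b => v b ^ 2) (fun _ _ => sq_nonneg _) (mem_univ b)
    exact ⟨fun b => (abs_le.mp ((sq_le_one_iff_abs_le_one _).mp (hle b))).1,
      fun b => (abs_le.mp ((sq_le_one_iff_abs_le_one _).mp (hle b))).2⟩
  have hne : {v : ι → ℝ | ∑ b, v b ^ 2 = 1}.Nonempty :=
    ⟨Pi.single (Classical.arbitrary ι) 1, by simp [Pi.single_apply, ite_pow]⟩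
  have hcont : Continuous fun v : ι → ℝ => frobSq (∑ b, v b • A b) := by
    simp only [frobSq, sum_smul_apply]
    fun_prop
  obtain ⟨v, hv, hmax⟩ := hcomp.exists_isMaxOn hne hcont.continuousOn
  refine ⟨v, hv, fun w => ?_⟩
  have hs0 : 0 ≤ ∑ b, w b ^ 2 := sum_nonneg fun _ _ => sq_nonneg _
  rcases hs0.eq_or_lt with hs | hs
  · have hw : ∀ b, w b = 0 := fun b => by
      simpa using (sum_eq_zero_iff_of_nonneg fun b _ => sq_nonneg (w b)).mp hs.symm b (mem_univ b)
    simp [hw, frobSq]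
  · set s := ∑ b, w b ^ 2 with hsdef
    have hr : (√s)⁻¹ ^ 2 = s⁻¹ := by rw [inv_pow, Real.sq_sqrt hs0]
    have hmem : (fun b => (√s)⁻¹ * w b) ∈ {v : ι → ℝ | ∑ b, v b ^ 2 = 1} := by
      simp only [Set.mem_ofPred_eq, mul_pow, ← mul_sum, hr, ← hsdef]
      exact inv_mul_cancel₀ hs.ne'
    have h := hmax hmem
    simp only [Set.mem_ofPred_eq, mul_smul, ← smul_sum, frobSq_smul, hr] at h
    rwa [inv_mul_le_iff₀ hs, mul_comm] at h

lemma isCompact_unit_symm_families :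
    IsCompact {A : ι → Matrix κ κ ℝ | ∑ b, frobSq (A b) = 1 ∧ ∀ b, (A b).IsSymm} := by
  have hIcc : IsCompact (Set.Icc (fun _ _ _ => -1 : ι → κ → κ → ℝ) fun _ _ _ => 1) :=
    isCompact_Icc
  have hclosed : IsClosed {A : ι → Matrix κ κ ℝ |
      ∑ b, frobSq (A b) = 1 ∧ ∀ b, (A b).IsSymm} := by
    refine IsClosed.and (isClosed_eq ?_ continuous_const) ?_
    · simp only [frobSq]
      fun_prop
    · simp only [Set.ofPred_forall]
      exact isClosed_iInter fun b => isClosed_eq (by fun_prop) (by fun_prop)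
  refine IsCompact.of_isClosed_subset (X := ι → Matrix κ κ ℝ) hIcc hclosed ?_
  rintro A ⟨hA, -⟩
  have hle : ∀ b i j, A b i j ^ 2 ≤ 1 := fun b i j => by
    rw [← hA]
    calc A b i j ^ 2 ≤ ∑ j, A b i j ^ 2 :=
          single_le_sum (f := fun j => A b i j ^ 2) (fun _ _ => sq_nonneg _) (mem_univ j)
      _ ≤ frobSq (A b) := single_le_sum (f := fun i => ∑ j, A b i j ^ 2)
          (fun _ _ => sum_nonneg fun _ _ => sq_nonneg _) (mem_univ i)
      _ ≤ _ := single_le_sum (f := fun b => frobSq (A b)) (fun _ _ => frobSq_nonneg _) (mem_univ b)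
  exact ⟨fun b i j => (abs_le.mp ((sq_le_one_iff_abs_le_one _).mp (hle b i j))).1,
    fun b i j => (abs_le.mp ((sq_le_one_iff_abs_le_one _).mp (hle b i j))).2⟩

/-- **The DDVV inequality**: for real symmetric matrices,
`∑ a b, ‖[A a, A b]‖² ≤ (∑ a, ‖A a‖²)²`. -/
theorem commSq_le_sq_sum_frobSq (D : ι → Matrix κ κ ℝ) (hD : ∀ b, (D b).IsSymm) :
    commSq D ≤ (∑ b, frobSq (D b)) ^ 2 := by
  classical
  set K := {A : ι → Matrix κ κ ℝ | ∑ b, frobSq (A b) = 1 ∧ ∀ b, (A b).IsSymm}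
  have hzero : ∀ A : ι → Matrix κ κ ℝ, ∑ b, frobSq (A b) = 0 → commSq A = 0 := by
    intro A hA
    have : ∀ b, A b = 0 := fun b => frobSq_eq_zero
      ((sum_eq_zero_iff_of_nonneg fun b _ => frobSq_nonneg (A b)).mp hA b (mem_univ b))
    simp [commSq, this, frobSq]
  have hN0 : ∀ A : ι → Matrix κ κ ℝ, 0 ≤ ∑ b, frobSq (A b) :=
    fun A => sum_nonneg fun b _ => frobSq_nonneg _
  have hscale : ∀ A : ι → Matrix κ κ ℝ, (∀ b, (A b).IsSymm) → 0 < ∑ b, frobSq (A b) →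
      (fun b => (√(∑ b, frobSq (A b)))⁻¹ • A b) ∈ K := by
    intro A hA hpos
    refine ⟨?_, fun b => (hA b).smul _⟩
    simp only [frobSq_smul, ← mul_sum]
    rw [inv_pow, Real.sq_sqrt hpos.le, inv_mul_cancel₀ hpos.ne']
  rcases (hN0 D).eq_or_lt with hs | hs
  · rw [hzero D hs.symm]
    positivity
  have hcont : Continuous fun A : ι → Matrix κ κ ℝ => commSq A := by
    simp only [commSq, frobSq]
    fun_prop
  obtain ⟨A, ⟨hA1, hAs⟩, hmax⟩ :=
    isCompact_unit_symm_families.exists_isMaxOn ⟨_, hscale D hD hs⟩ hcont.continuousOn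
  have hbound : ∀ A' : ι → Matrix κ κ ℝ, (∀ b, (A' b).IsSymm) →
      commSq A' ≤ commSq A * (∑ b, frobSq (A' b)) ^ 2 := by
    intro A' hA'
    rcases (hN0 A').eq_or_lt with hs' | hs'
    · rw [hzero A' hs'.symm, ← hs']
      simp
    · have h := hmax (hscale A' hA' hs')
      simp only [Set.mem_ofPred_eq, commSq_smul] at h
      have hr : (√(∑ b, frobSq (A' b)))⁻¹ ^ 4 = ((∑ b, frobSq (A' b)) ^ 2)⁻¹ := by
        rw [inv_pow, show (4 : ℕ) = 2 * 2 from rfl, pow_mul, Real.sq_sqrt hs'.le]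
      rwa [hr, inv_mul_le_iff₀ (by positivity), mul_comm] at h
  suffices hc : commSq A ≤ 1 from
    (hbound D hD).trans (mul_le_of_le_one_left (sq_nonneg _) hc)
  have : Nonempty ι := by
    by_contra hι
    rw [not_nonempty_iff] at hι
    simp at hA1
  obtain ⟨v, hv, hlong⟩ := exists_longest_combination A
  set B := ∑ b, v b • A b with hB
  have hBpos : 0 < frobSq B := by
    by_contra! hle
    have h0 : ∀ b, frobSq (A b) ≤ 0 := fun b => by
      have := hlong (Pi.single b 1)
      simp [Pi.single_apply, ite_pow, ite_smul] at this
      linarith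
    linarith [sum_nonpos fun b (_ : b ∈ univ) => h0 b]
  have hBs : B.IsSymm := by
    rw [IsSymm, hB, transpose_sum]
    exact sum_congr rfl fun b _ => by rw [transpose_smul, (hAs b).eq]
  have hS := sum_frobSq_commutator_le A hAs v hv B hB hlong
  rw [hA1, mul_one] at hS
  set S := ∑ b, frobSq (B * A b - A b * B)
  set s := frobSq B
  set c := commSq A
  have hvar : ∀ t : ℝ, 0 < t → c * (s * (2 - t) * (2 - 2 * t * s + t ^ 2 * s)) ≤ 4 * S := by
    intro t ht
    have h1 := (le_commSq_variation A v B hB (-t)).trans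
      (hbound _ fun a => (hAs a).add ((hBs.smul _).smul _))
    rw [sum_frobSq_variation A v hv B hB, hA1] at h1
    refine le_of_mul_le_mul_left ?_ ht
    change c + 4 * -t * S ≤ c * (1 + 2 * -t * s + (-t) ^ 2 * s) ^ 2 at h1
    linarith
  have hlim : c * (s * (2 - 0) * (2 - 2 * 0 * s + 0 ^ 2 * s)) ≤ 4 * S := by
    have hc : Continuous fun t : ℝ => c * (s * (2 - t) * (2 - 2 * t * s + t ^ 2 * s)) := by
      fun_prop
    exact le_of_tendsto ((hc.tendsto 0).mono_left nhdsWithin_le_nhds)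
      (Filter.eventually_of_mem (self_mem_nhdsWithin (s := Set.Ioi (0 : ℝ))) hvar)
  by_contra! hgt
  nlinarith

end Wintgen

section Frame

/-- A symmetric array with zero diagonal sums to twice its strictly upper triangular part. -/
lemma two_mul_sum_lt {k : ℕ} (f : Fin k → Fin k → ℝ) (hs : ∀ i j, f i j = f j i)
    (h0 : ∀ i, f i i = 0) :
    2 * (∑ i, ∑ j, if i < j then f i j else 0) = ∑ i, ∑ j, f i j := by
  have hflip : (∑ i, ∑ j, if i < j then f i j else 0) = ∑ i, ∑ j, if j < i then f i j else 0 := by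
    rw [sum_comm]
    exact sum_congr rfl fun i _ => sum_congr rfl fun j _ => by rw [hs]
  rw [two_mul]
  nth_rewrite 2 [hflip]
  simp only [← sum_add_distrib]
  refine sum_congr rfl fun i _ => sum_congr rfl fun j _ => ?_
  rcases lt_trichotomy i j with h | h | h
  · simp [h, h.not_gt]
  · subst h
    simp [h0]
  · simp [h, h.not_gt]

/-- The normal curvature sum over `i < j`, `r < s` is a quarter of the full commutator sum. -/
lemma four_mul_sum_normal_curvature {n k : ℕ} (h : Fin k → Matrix (Fin n) (Fin n) ℝ)
    (hsymm : ∀ r, (h r).IsSymm) :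
    4 * (∑ i : Fin n, ∑ j : Fin n, ∑ r : Fin k, ∑ s : Fin k,
      if i < j ∧ r < s then (h r * h s - h s * h r) j i ^ 2 else 0) = commSq h := by
  have hanti : ∀ r s, (h r * h s - h s * h r)ᵀ = -(h r * h s - h s * h r) := fun r s => by
    rw [transpose_sub, transpose_mul, transpose_mul, (hsymm r).eq, (hsymm s).eq, neg_sub]
  have hskew : ∀ r s i j, (h r * h s - h s * h r) j i = -(h r * h s - h s * h r) i j :=
    fun r s i j => congrFun (congrFun (hanti r s) i) j
  have hrs : ∀ r s i j, (h r * h s - h s * h r) j i = -(h s * h r - h r * h s) j i :=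
    fun r s i j => by simp
  set f : Fin n → Fin n → ℝ := fun i j =>
    ∑ r, ∑ s, if r < s then (h r * h s - h s * h r) j i ^ 2 else 0 with hf
  have hfs : ∀ i j, f i j = f j i := fun i j => by
    simp only [hf]
    refine sum_congr rfl fun r _ => sum_congr rfl fun s _ => ?_
    rw [hskew r s i j, neg_sq]
  have hf0 : ∀ i, f i i = 0 := fun i => by
    simp only [hf]
    refine sum_eq_zero fun r _ => sum_eq_zero fun s _ => ?_
    have := hskew r s i i
    rw [show (h r * h s - h s * h r) i i = 0 by linarith]
    simp
  have hf2 : ∀ i j, 2 * f i j = ∑ r, ∑ s, (h r * h s - h s * h r) j i ^ 2 := fun i j =>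
    two_mul_sum_lt (fun r s => (h r * h s - h s * h r) j i ^ 2)
      (fun r s => by rw [hrs r s, neg_sq]) (fun r => by simp)
  have hite : (∑ i : Fin n, ∑ j : Fin n, ∑ r : Fin k, ∑ s : Fin k,
      if i < j ∧ r < s then (h r * h s - h s * h r) j i ^ 2 else 0)
      = ∑ i, ∑ j, if i < j then f i j else 0 := by
    refine sum_congr rfl fun i _ => sum_congr rfl fun j _ => ?_
    by_cases hij : i < j <;> simp [hij, hf]
  calc _ = 2 * ∑ i, ∑ j, f i j := by rw [hite, ← two_mul_sum_lt f hfs hf0]; ring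
    _ = ∑ i, ∑ j, ∑ r, ∑ s, (h r * h s - h s * h r) j i ^ 2 := by
        simp only [mul_sum (a := (2 : ℝ)), hf2]
    _ = ∑ r, ∑ s, ∑ j, ∑ i, (h r * h s - h s * h r) j i ^ 2 := by
        rw [sum_comm]
        refine Eq.symm (((sum_congr rfl fun r _ => sum_comm).trans sum_comm).trans ?_)
        exact sum_congr rfl fun j _ => (sum_congr rfl fun r _ => sum_comm).trans sum_comm
    _ = commSq h := rfl

lemma commSq_sub_smul_one {ι κ : Type*} [Fintype ι] [Fintype κ] [DecidableEq κ]
    (A : ι → Matrix κ κ ℝ) (c : ι → ℝ) :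
    commSq (fun r => A r - c r • (1 : Matrix κ κ ℝ)) = commSq A := by
  refine sum_congr rfl fun r _ => sum_congr rfl fun s _ => ?_
  congr 1
  simp only [Matrix.sub_mul, Matrix.mul_sub, smul_mul_assoc, mul_smul_comm, Matrix.one_mul,
    Matrix.mul_one]
  module

/-- The squared norm of the traceless part of a matrix. -/
lemma frobSq_sub_trace {n : ℕ} (hn : (n : ℝ) ≠ 0) (X : Matrix (Fin n) (Fin n) ℝ) :
    frobSq (X - ((∑ i, X i i) / n) • (1 : Matrix (Fin n) (Fin n) ℝ))
      = frobSq X - (∑ i, X i i) ^ 2 / n := by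
  set c := (∑ i, X i i) / (n : ℝ) with hc
  have hT : ∑ i, X i i = n * c := by rw [hc]; field_simp
  have hpt : ∀ i j, (X - c • (1 : Matrix (Fin n) (Fin n) ℝ)) i j ^ 2
      = X i j ^ 2 + if i = j then c ^ 2 - 2 * c * X i i else 0 := by
    intro i j
    by_cases hij : i = j
    · subst hij
      simp
      ring
    · simp [hij]
  simp only [frobSq, hpt, sum_add_distrib, sum_ite_eq, mem_univ, if_true, sum_sub_distrib,
    ← mul_sum, hT, sum_const, card_univ, Fintype.card_fin, nsmul_eq_mul]
  field_simp
  ring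

/-- Twice the scalar curvature of a submanifold of a manifold of quasi-constant curvature. -/
lemma two_mul_scalarCurv {n m : ℕ} (hnm : n ≤ m)
    (Rt : Fin m → Fin m → Fin m → Fin m → ℝ) (R : Fin n → Fin n → Fin n → Fin n → ℝ)
    (h : Fin (m - n) → Matrix (Fin n) (Fin n) ℝ) (hsymm : ∀ r, (h r).IsSymm)
    (p q : ℝ) (ψ : Fin m → ℝ)
    (quasi : ∀ x y z w : Fin m, Rt x y z w =
      p * (kdelta y z * kdelta x w - kdelta x z * kdelta y w)
      + q * (kdelta x w * ψ y * ψ z - kdelta x z * ψ y * ψ w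
          + kdelta y z * ψ x * ψ w - kdelta y w * ψ x * ψ z))
    (gauss : ∀ i j k l : Fin n, R i j k l =
      Rt (Fin.castLE hnm i) (Fin.castLE hnm j) (Fin.castLE hnm k) (Fin.castLE hnm l)
      + ∑ r : Fin (m - n), (h r i l * h r j k - h r i k * h r j l)) :
    2 * scalarCurv R = p * (n * (n - 1)) + q * (2 * (n - 1) * ∑ j, ψ (Fin.castLE hnm j) ^ 2)
      + ∑ r, ((∑ i, h r i i) ^ 2 - frobSq (h r)) := by
  have hR : ∀ i j, R i j j i =
      p + q * (ψ (Fin.castLE hnm j) ^ 2 + ψ (Fin.castLE hnm i) ^ 2)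
      + (if i = j then -p - 2 * q * ψ (Fin.castLE hnm i) ^ 2 else 0)
      + ∑ r, (h r i i * h r j j - h r i j ^ 2) := by
    intro i j
    have hsum : ∀ r, h r i j * h r j i = h r i j ^ 2 := fun r => by
      rw [(hsymm r).apply i j, sq]
    rw [gauss, quasi]
    simp only [hsum]
    congr 1
    by_cases hij : i = j
    · subst hij
      simp [kdelta]
      ring
    · have hij' : j ≠ i := Ne.symm hij
      simp only [kdelta, (Fin.castLE_injective hnm).eq_iff, hij, hij', if_true, if_false]
      ring
  have hRs : ∀ i j, R i j j i = R j i i j := fun i j => by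
    rw [hR, hR]
    have hsum : ∑ r, (h r i i * h r j j - h r i j ^ 2) = ∑ r, (h r j j * h r i i - h r j i ^ 2) :=
      sum_congr rfl fun r _ => by rw [(hsymm r).apply i j, mul_comm]
    rw [hsum]
    by_cases hij : i = j
    · subst hij
      rfl
    · simp only [hij, Ne.symm hij, if_false]
      ring
  have hR0 : ∀ i, R i i i i = 0 := fun i => by
    rw [hR]
    have hsum : ∑ r, (h r i i * h r i i - h r i i ^ 2) = 0 :=
      sum_eq_zero fun r _ => by ring
    rw [hsum]
    simp
    ring
  rw [scalarCurv, two_mul_sum_lt (fun i j => R i j j i) hRs hR0]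
  have hh : ∑ i, ∑ j, ∑ r, (h r i i * h r j j - h r i j ^ 2)
      = ∑ r, ((∑ i, h r i i) ^ 2 - frobSq (h r)) := by
    have hr : ∀ r, (∑ i, h r i i) ^ 2 - frobSq (h r)
        = ∑ i, ∑ j, (h r i i * h r j j - h r i j ^ 2) := fun r => by
      rw [sq, sum_mul_sum, frobSq]
      simp only [sum_sub_distrib]
    simp only [hr]
    conv_rhs => rw [sum_comm]
    refine sum_congr rfl fun i _ => ?_
    rw [sum_comm]
  simp only [hR, sum_add_distrib, hh]
  simp only [← mul_sum, sum_add_distrib, sum_const, card_univ, Fintype.card_fin, nsmul_eq_mul,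
    sum_ite_eq, mem_univ, if_true, sum_sub_distrib]
  ring

end Frame

/-- **Generalized Wintgen inequality in a manifold of quasi-constant curvature
(`ρ^⊥` version, tangent / normal cases).**  If the distinguished unit vector field `V`
is everywhere tangent to the submanifold, then `ρ + ρ^⊥ ≤ ‖H‖² + p + 2q/n`; if `V` is
everywhere normal to the submanifold, then `ρ + ρ^⊥ ≤ ‖H‖² + p`. -/
theorem wintgen_rhoPerp_quasi_constant_tangent_normal {n m : ℕ}
    (hn : 3 ≤ n) (hm : 4 ≤ m) (hnm : n ≤ m)
    (Rt : Fin m → Fin m → Fin m → Fin m → ℝ)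
    (R : Fin n → Fin n → Fin n → Fin n → ℝ)
    (h : Fin (m - n) → Matrix (Fin n) (Fin n) ℝ)
    (hsymm : ∀ r, (h r).IsSymm)
    (p q : ℝ) (ψ : Fin m → ℝ) (hψ : ∑ x : Fin m, ψ x ^ 2 = 1)
    (Rperp : Fin n → Fin n → Fin (m - n) → Fin (m - n) → ℝ)
    (ricci : ∀ (i j : Fin n) (r s : Fin (m - n)),
      Rperp i j r s = (h r * h s - h s * h r) j i)
    (quasi : ∀ x y z w : Fin m, Rt x y z w =
      p * (kdelta y z * kdelta x w - kdelta x z * kdelta y w)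
      + q * (kdelta x w * ψ y * ψ z - kdelta x z * ψ y * ψ w
          + kdelta y z * ψ x * ψ w - kdelta y w * ψ x * ψ z))
    (gauss : ∀ i j k l : Fin n, R i j k l =
      Rt (Fin.castLE hnm i) (Fin.castLE hnm j) (Fin.castLE hnm k) (Fin.castLE hnm l)
      + ∑ r : Fin (m - n), (h r i l * h r j k - h r i k * h r j l)) :
    ((∀ x : Fin m, n ≤ (x : ℕ) → ψ x = 0) →
      normScalarCurv R + rhoPerp Rperp ≤ meanCurvSq h + p + 2 * q / (n : ℝ)) ∧
    ((∀ j : Fin n, ψ (Fin.castLE hnm j) = 0) →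
      normScalarCurv R + rhoPerp Rperp ≤ meanCurvSq h + p) := by
  have hn3 : (3 : ℝ) ≤ n := by exact_mod_cast hn
  have hn0 : (n : ℝ) ≠ 0 := by linarith
  have hn1 : (n : ℝ) - 1 ≠ 0 := by linarith
  have hnpos : 0 < (n : ℝ) * (n - 1) := mul_pos (by linarith) (by linarith)
  set A : Fin (m - n) → Matrix (Fin n) (Fin n) ℝ := fun r =>
    h r - ((∑ i, h r i i) / n) • (1 : Matrix (Fin n) (Fin n) ℝ) with hA
  have hAsymm : ∀ r, (A r).IsSymm := fun r => (hsymm r).sub (isSymm_one.smul _)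
  have hnormal : 2 * √(∑ i : Fin n, ∑ j : Fin n, ∑ r : Fin (m - n), ∑ s : Fin (m - n),
      if i < j ∧ r < s then Rperp i j r s ^ 2 else 0) ≤ ∑ r, frobSq (A r) := by
    have hddvv := commSq_le_sq_sum_frobSq A hAsymm
    rw [commSq_sub_smul_one, ← four_mul_sum_normal_curvature h hsymm] at hddvv
    simp only [ricci]
    rw [show (2 : ℝ) = √4 by rw [show (4 : ℝ) = 2 ^ 2 by norm_num]; simp,
      ← Real.sqrt_mul (by norm_num)]
    exact Real.sqrt_le_iff.mpr ⟨sum_nonneg fun r _ => frobSq_nonneg _, hddvv⟩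
  have hbound : normScalarCurv R + rhoPerp Rperp ≤
      meanCurvSq h + p + 2 * q / (n : ℝ) * ∑ j, ψ (Fin.castLE hnm j) ^ 2 := by
    have hAsq : ∑ r, frobSq (A r) = ∑ r, frobSq (h r) - (∑ r, (∑ i, h r i i) ^ 2) / n := by
      simp only [hA, frobSq_sub_trace hn0, sum_sub_distrib]
      rw [sum_div]
    have hmean : meanCurvSq h = (∑ r, (∑ i, h r i i) ^ 2) / (n : ℝ) ^ 2 := by
      rw [meanCurvSq, sum_div]
      exact sum_congr rfl fun r _ => by ring
    have hrho : normScalarCurv R = meanCurvSq h + p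
        + 2 * q / (n : ℝ) * ∑ j, ψ (Fin.castLE hnm j) ^ 2
        - (∑ r, frobSq (A r)) / ((n : ℝ) * (n - 1)) := by
      rw [normScalarCurv, two_mul_scalarCurv hnm Rt R h hsymm p q ψ quasi gauss, hmean, hAsq,
        sum_sub_distrib]
      field_simp
      ring
    have hperp : rhoPerp Rperp ≤ (∑ r, frobSq (A r)) / ((n : ℝ) * (n - 1)) := by
      rw [rhoPerp, div_mul_eq_mul_div]
      gcongr
    linarith
  constructor
  · intro hψ0
    have hone : ∑ j, ψ (Fin.castLE hnm j) ^ 2 = 1 := by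
      rw [← hψ]
      refine Fintype.sum_of_injective _ (Fin.castLE_injective hnm) _ _ (fun x hx => ?_)
        fun _ => rfl
      have hxn : n ≤ (x : ℕ) := by
        by_contra! hlt
        exact hx ⟨⟨x, hlt⟩, rfl⟩
      rw [hψ0 x hxn]
      norm_num
    rwa [hone, mul_one] at hbound
  · intro hψ0
    simpa [hψ0] using hbound
end
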